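/- arXiv:0709.3128 — 8 statements merged into one kernel-verified Lean document; each statement's English description precedes it below -/
import Mathlib

section
/- Let q be an odd prime power, K a field extension of 𝔽_q, and β ∈ K with β^q = β, β ≠ 0 and β ≠ −1. If γ ∈ K satisfies γ^{q-1}·(1+β) = β, then γ^{q²} = γ if and only if 2β + 1 = 0 (i.e. β = −1/2). -/
/-- `q` odd prime power, `β ∈ 𝔽_q ⊆ K`, `β ≠ 0`, `β ≠ -1`, `γ^(q-1)·(1+β) = β`:
then `γ ∈ 𝔽_{q²}` iff `β = -1/2`. -/
theorem stmt5 (p e : ℕ) (hp : p.Prime) (hp2 : p ≠ 2) (he : 0 < e) {K : Type*} [Field K]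
    [CharP K p] (β γ : K) (hβ : β ^ p ^ e = β) (hβ0 : β ≠ 0) (hβ1 : β ≠ -1)
    (hγ : γ ^ (p ^ e - 1) * (1 + β) = β) :
    γ ^ (p ^ e) ^ 2 = γ ↔ 2 * β + 1 = 0 := by
  have : Fact p.Prime := ⟨hp⟩
  have hq : 1 < p ^ e := Nat.one_lt_pow he.ne' hp.one_lt
  have hβ1' : 1 + β ≠ 0 := fun h => hβ1 (by linear_combination h)
  have hγ0 : γ ≠ 0 := by
    rintro rfl
    rw [zero_pow (by omega), zero_mul] at hγ
    exact hβ0 hγ.symm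
  have hfrob : (1 + β) * γ ^ p ^ e = β * γ := by
    rw [← pow_sub_one_mul (by omega : p ^ e ≠ 0) γ]
    linear_combination γ * hγ
  have hfrob' : (1 + β) * γ ^ (p ^ e) ^ 2 = β * γ ^ p ^ e := by
    have h := congrArg (· ^ p ^ e) hfrob
    simp only [mul_pow, add_pow_char_pow, one_pow, hβ] at h
    rwa [sq, pow_mul]
  have hsq : (1 + β) ^ 2 * γ ^ (p ^ e) ^ 2 = β ^ 2 * γ := by
    linear_combination (1 + β) * hfrob' + β * hfrob
  constructor
  · intro h
    rw [h] at hsq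
    have h' := mul_right_cancel₀ hγ0 hsq
    linear_combination h'
  · intro h
    refine mul_left_cancel₀ (pow_ne_zero 2 hβ1') ?_
    linear_combination hsq - γ * h
end

section
/- Let q = 2^e with e ≥ 2 (so q > 2 and char = 2), K a field extension of 𝔽_q, and β ∈ K with β^q = β, β ≠ 0 and β ≠ 1. If γ ∈ K satisfies γ^{q-1}·(1+β) = β, then γ^{q²} ≠ γ; that is, γ does not lie in 𝔽_{q²}. -/
/-- `q = 2^e`, `e ≥ 2`, `β ∈ 𝔽_q ⊆ K`, `β ≠ 0`, `β ≠ 1`, `γ^(q-1)·(1+β) = β`: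
then `γ ∉ 𝔽_{q²}`. -/
theorem stmt6 (e : ℕ) (he : 2 ≤ e) {K : Type*} [Field K] [CharP K 2]
    (β γ : K) (hβ : β ^ 2 ^ e = β) (hβ0 : β ≠ 0) (hβ1 : β ≠ 1)
    (hγ : γ ^ (2 ^ e - 1) * (1 + β) = β) : γ ^ (2 ^ e) ^ 2 ≠ γ := by
  intro h
  have hq : 2 ^ e - 1 ≠ 0 := by
    have : 1 < 2 ^ e := Nat.one_lt_two_pow (by omega)
    omega
  have hγ0 : γ ≠ 0 := by
    rintro rfl
    exact hβ0 (by simpa [zero_pow hq] using hγ.symm)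
  have hfrob : γ ^ 2 ^ e * (1 + β) = β * γ := by
    rw [← pow_sub_one_mul (by positivity : 2 ^ e ≠ 0) γ, mul_right_comm, hγ]
  have hfrob_sq : γ * (1 + β) = β * γ ^ 2 ^ e := by
    have : (γ ^ 2 ^ e * (1 + β)) ^ 2 ^ e = (β * γ) ^ 2 ^ e := by rw [hfrob]
    rwa [mul_pow, mul_pow, add_pow_char_pow, one_pow, hβ, ← pow_mul, ← sq, h] at this
  have h2 : (2 : K) = 0 := CharTwo.two_eq_zero
  have hγ_eq : γ = 0 := by
    linear_combination (1 + β) * hfrob_sq + β * hfrob - γ * β * h2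
  exact hγ0 hγ_eq
end

section
/- Let q be an odd prime power and t ≥ 2 an integer. There exists a tuple (α₁, …, α_t) of elements of 𝔽_{q²} satisfying α₁² = −1, α_i²·α_{i-1} = −1 for all i with 2 ≤ i ≤ t−1, and α_t^{q-1} = −α_{t-1}, if and only if q ≡ −1 (mod 2^t). -/
/-- Descending the recursion `a_{i-1} = -a_i⁻²` from `z` with `z ^ 2 ^ (n + 1) = -1`. -/
theorem iterate_neg_inv_sq_pow {F : Type*} [Field F] {z : F} {n : ℕ}
    (hz : z ^ 2 ^ (n + 1) = -1) (j k : ℕ) (hjk : j + k = n) :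
    ((fun x : F => -(x ^ 2)⁻¹)^[j] z) ^ 2 ^ (k + 1) = -1 := by
  induction j generalizing k with
  | zero => obtain rfl : k = n := by omega
            simpa using hz
  | succ j ih =>
    have h := ih (k + 1) (by omega)
    have he : Even (2 ^ (k + 1)) := ⟨2 ^ k, by ring⟩
    rw [Function.iterate_succ_apply', he.neg_pow, inv_pow, ← pow_mul, ← pow_succ', h]
    norm_num

/-- In a finite field with `q ^ 2` elements, `q` odd, if `2 ^ (n + 1) ∣ q + 1` then some
`(q - 1)`-st power is a `2 ^ n`-th root of `-1`. -/
theorem exists_pow_sub_one_pow_two_pow_eq_neg_one {F : Type*} [Field F] [Fintype F] {q n : ℕ}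
    (hq : 1 < q) (hF : Fintype.card F = q ^ 2) (h : 2 ^ (n + 1) ∣ q + 1) :
    ∃ x : F, (x ^ (q - 1)) ^ 2 ^ n = -1 := by
  classical
  obtain ⟨m, hm⟩ := h
  obtain ⟨g, hg⟩ := IsCyclic.exists_generator (α := Fˣ)
  have hord : orderOf g = (q - 1) * (q + 1) := by
    rw [orderOf_eq_card_of_forall_mem_zpowers hg, Nat.card_eq_fintype_card,
      Fintype.card_units, hF, mul_comm, ← Nat.sq_sub_sq, one_pow]
  have hexp : 2 * (m * (q - 1) * 2 ^ n) = (q - 1) * (q + 1) := by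
    rw [hm]; ring
  have hpos : 0 < (q - 1) * (q + 1) := Nat.mul_pos (by omega) (by omega)
  refine ⟨(g ^ m : Fˣ), ?_⟩
  have hsq : ((g ^ (m * (q - 1) * 2 ^ n) : Fˣ) : F) ^ 2 = 1 := by
    rw [← Units.val_pow_eq_pow_val, ← pow_mul, mul_comm, hexp, ← hord, pow_orderOf_eq_one,
      Units.val_one]
  rw [← Units.val_pow_eq_pow_val, ← Units.val_pow_eq_pow_val, ← pow_mul, ← pow_mul, ← mul_assoc]
  refine (mul_self_eq_one_iff.mp ((sq _).symm.trans hsq)).resolve_left fun h1 => ?_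
  have := Nat.le_of_dvd (by omega) (orderOf_dvd_of_pow_eq_one (Units.val_eq_one.mp h1))
  omega

/-- `q` odd prime power, `t ≥ 2`. A tuple `(α₁, …, α_t)` in `𝔽_{q²}` with `α₁² = -1`,
`α_i²·α_{i-1} = -1` for `2 ≤ i ≤ t-1`, and `α_t^(q-1) = -α_{t-1}` exists iff
`q ≡ -1 (mod 2^t)`.  (Here `α (i-1)` encodes `α_i`.) -/
theorem stmt8 (q t : ℕ) (hq : IsPrimePow q) (hodd : Odd q) (ht : 2 ≤ t)
    {F : Type*} [Field F] [Fintype F] (hF : Fintype.card F = q ^ 2) :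
    (∃ α : Fin t → F,
      (α ⟨0, by omega⟩) ^ 2 = -1 ∧
      (∀ i : ℕ, ∀ _ : 2 ≤ i, ∀ _ : i ≤ t - 1,
        (α ⟨i - 1, by omega⟩) ^ 2 * α ⟨i - 2, by omega⟩ = -1) ∧
      (α ⟨t - 1, by omega⟩) ^ (q - 1) = -(α ⟨t - 2, by omega⟩)) ↔
    2 ^ t ∣ q + 1 := by
  have hq1 := hq.one_lt
  have hne : (-1 : F) ≠ 1 := fun h => by
    have h2 : ringChar F = 2 := by
      by_contra hc
      exact Ring.neg_one_ne_one_of_char_ne_two hc h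
    have := FiniteField.even_card_of_char_two h2
    have ho : Odd (q ^ 2) := hodd.pow
    rw [hF] at this
    rw [Nat.odd_iff] at ho
    omega
  obtain ⟨n, rfl⟩ : ∃ n, t = n + 2 := ⟨t - 2, by omega⟩
  constructor
  · rintro ⟨α, h1, h2, h3⟩
    have hpow : ∀ i (hi : i ≤ n), α ⟨i, by omega⟩ ^ 2 ^ (i + 1) = -1 := by
      intro i
      induction i with
      | zero => intro _; simpa using h1
      | succ i ih =>
        intro hi
        have hr := h2 (i + 2) (by omega) (by omega)
        have he : Even (2 ^ (i + 1)) := ⟨2 ^ i, by ring⟩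
        have h := congrArg (· ^ 2 ^ (i + 1)) hr
        simp only [mul_pow, he.neg_one_pow, ← pow_mul, ← pow_succ'] at h
        have h' := ih (by omega)
        simp only [Nat.add_sub_cancel, show i + 2 - 1 = i + 1 by omega, h'] at h
        linear_combination -h
    have hz := hpow n le_rfl
    have hord : orderOf (α ⟨n, by omega⟩) = 2 ^ (n + 2) := by
      refine orderOf_eq_prime_pow (by rw [hz]; exact hne) ?_
      rw [pow_succ, pow_mul, hz]; norm_num
    rw [← hord]
    apply orderOf_dvd_of_pow_eq_one
    simp only [Nat.add_sub_cancel] at h3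
    have hx : α ⟨n + 2 - 1, by omega⟩ ≠ 0 := by
      intro h0
      rw [h0, zero_pow (by omega), eq_comm, neg_eq_zero] at h3
      rw [h3, zero_pow (by positivity)] at hz
      exact neg_ne_zero.mpr one_ne_zero hz.symm
    rw [← (hodd.add_one).neg_pow, ← h3, ← pow_mul, mul_comm, ← Nat.sq_sub_sq q 1, one_pow, ← hF]
    exact FiniteField.pow_card_sub_one_eq_one _ hx
  · intro h
    obtain ⟨x, hx⟩ := exists_pow_sub_one_pow_two_pow_eq_neg_one hq1 hF h
    have he : Even (2 ^ (n + 1)) := ⟨2 ^ n, by ring⟩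
    have key := iterate_neg_inv_sq_pow (z := -x ^ (q - 1)) (n := n) (by rw [he.neg_pow, hx])
    refine ⟨fun i => if (i : ℕ) = n + 1 then x else
      (fun y : F => -(y ^ 2)⁻¹)^[n - i] (-x ^ (q - 1)), ?_, fun i hi hit => ?_, ?_⟩
    · simpa using key n 0 rfl
    · have hk := key (n - (i - 1)) (i - 1) (by omega)
      simp only [show i - 1 ≠ n + 1 by omega, show i - 2 ≠ n + 1 by omega, if_false,
        show n - (i - 2) = n - (i - 1) + 1 by omega, Function.iterate_succ_apply']
      set y := (fun y : F => -(y ^ 2)⁻¹)^[n - (i - 1)] (-x ^ (q - 1))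
      have hy : y ≠ 0 := by
        intro h0
        rw [h0, zero_pow (by positivity)] at hk
        exact neg_ne_zero.mpr one_ne_zero hk.symm
      field_simp
    · simp
end

section
/- Let q be an odd prime power and t ≥ 2 an integer with q ≡ −1 (mod 2^t). Then the number of tuples (α₁, …, α_t) ∈ (𝔽_{q²})^t satisfying α₁² = −1, α_i²·α_{i-1} = −1 for all i with 2 ≤ i ≤ t−1, and α_t^{q-1} = −α_{t-1}, is exactly 2^{t-1}(q−1). -/
/-- If `n * m = |F| - 1` and `x ^ m = 1`, then `x` has exactly `n` distinct `n`-th roots in `F`. -/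
theorem FiniteField.card_pow_eq {F : Type*} [Field F] [Fintype F] {n m : ℕ}
    (hnm : Fintype.card F - 1 = n * m) {x : F} (hx : x ^ m = 1) :
    Nat.card {y : F // y ^ n = x} = n := by
  classical
  have hpos : 0 < n * m := hnm ▸ Nat.sub_pos_of_lt Fintype.one_lt_card
  have hn : 0 < n := Nat.pos_of_mul_pos_right hpos
  have hm : 0 < m := Nat.pos_of_mul_pos_left hpos
  obtain ⟨g, hg⟩ := IsCyclic.exists_generator (α := Fˣ)
  have hord : orderOf g = n * m := by
    rw [orderOf_eq_card_of_forall_mem_zpowers hg, Nat.card_eq_fintype_card, Fintype.card_units, hnm]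
  have hprim : IsPrimitiveRoot (g : F) (n * m) := by
    rw [← hord, IsPrimitiveRoot.coe_units_iff]
    exact IsPrimitiveRoot.orderOf g
  have hζ : IsPrimitiveRoot ((g : F) ^ m) n := hprim.pow hpos (mul_comm n m)
  have hroot : ∃ y : F, y ^ n = x := by
    have : NeZero (n * m) := ⟨hpos.ne'⟩
    obtain ⟨j, -, rfl⟩ := hprim.eq_pow_of_pow_eq_one
      (ξ := x) (by rw [mul_comm, pow_mul, hx, one_pow])
    rw [← pow_mul, hprim.pow_eq_one_iff_dvd] at hx
    obtain ⟨c, rfl⟩ := Nat.dvd_of_mul_dvd_mul_right hm hx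
    exact ⟨(g : F) ^ c, by rw [← pow_mul, mul_comm]⟩
  have hx0 : x ≠ 0 := by
    rintro rfl
    rw [zero_pow hm.ne'] at hx
    exact zero_ne_one hx
  have hcard := hζ.card_nthRoots x
  rw [if_pos hroot, ← Multiset.toFinset_card_of_nodup (hζ.nthRoots_nodup hx0)] at hcard
  conv_rhs => rw [← hcard]
  rw [Nat.subtype_card]
  intro y
  simp [Polynomial.mem_nthRoots hn]

theorem Fin.card_init_and_last {F : Type*} [Finite F] {n : ℕ} (P : (Fin n → F) → Prop)
    (R : (Fin n → F) → F → Prop) (m : ℕ) (h : ∀ a, P a → Nat.card {x // R a x} = m) :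
    Nat.card {α : Fin (n + 1) → F // P (Fin.init α) ∧ R (Fin.init α) (α (Fin.last n))} =
      Nat.card {a // P a} * m := by
  classical
  have := Fintype.ofFinite {a // P a}
  let e : {α : Fin (n + 1) → F // P (Fin.init α) ∧ R (Fin.init α) (α (Fin.last n))} ≃
      Σ a : {a // P a}, {x // R a x} :=
    { toFun := fun α => ⟨⟨Fin.init α.1, α.2.1⟩, ⟨α.1 (Fin.last n), α.2.2⟩⟩
      invFun := fun s => ⟨Fin.snoc (α := fun _ => F) s.1.1 s.2.1, by
        simpa using ⟨s.1.2, s.2.2⟩⟩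
      left_inv := fun α => Subtype.ext (Fin.snoc_init_self α.1)
      right_inv := by
        rintro ⟨⟨a, ha⟩, ⟨x, hx⟩⟩
        refine Sigma.subtype_ext ?_ ?_ <;> simp }
  rw [Nat.card_congr e, Nat.card_sigma, Finset.sum_congr rfl fun a _ => h a.1 a.2]
  simp [Nat.card_eq_fintype_card]

/-- `α 0 ^ 2 = -1`, and each later entry squared times its predecessor is `-1`. -/
def IsSqChain {F : Type*} [Field F] {k : ℕ} (α : Fin (k + 1) → F) : Prop :=
  α 0 ^ 2 = -1 ∧ ∀ i : ℕ, ∀ h : i + 1 < k + 1, α ⟨i + 1, h⟩ ^ 2 * α ⟨i, by omega⟩ = -1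

theorem IsSqChain.pow_eq_one {F : Type*} [Field F] {k : ℕ} {α : Fin (k + 1) → F}
    (hα : IsSqChain α) (i : ℕ) (h : i < k + 1) : α ⟨i, h⟩ ^ 2 ^ (i + 2) = 1 := by
  induction i with
  | zero =>
    have h0 : α ⟨0, h⟩ ^ 2 = -1 := hα.1
    linear_combination (α ⟨0, h⟩ ^ 2 - 1) * h0
  | succ i ih =>
    have hmul := congrArg (· ^ 2 ^ (i + 2)) (hα.2 i h)
    have heven : Even (2 ^ (i + 2)) := (Nat.even_pow.2 ⟨even_two, by omega⟩)
    simp only [mul_pow, ih, mul_one, heven.neg_one_pow, ← pow_mul] at hmul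
    rw [← hmul]
    congr 1
    ring

theorem isSqChain_succ_iff {F : Type*} [Field F] {k : ℕ} (α : Fin (k + 2) → F) :
    IsSqChain α ↔ IsSqChain (Fin.init α : Fin (k + 1) → F) ∧
      α (Fin.last (k + 1)) ^ 2 * (Fin.init α : Fin (k + 1) → F) (Fin.last k) = -1 := by
  constructor
  · rintro ⟨h0, h⟩
    exact ⟨⟨h0, fun i hi => h i (by omega)⟩, h k (by omega)⟩
  · rintro ⟨⟨h0, h⟩, hl⟩
    refine ⟨h0, fun i hi => ?_⟩
    rcases Nat.lt_or_ge (i + 1) (k + 1) with hlt | hge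
    · exact h i hlt
    · obtain rfl : i = k := by omega
      exact hl

theorem card_isSqChain {F : Type*} [Field F] [Fintype F] (k : ℕ)
    (hdvd : 2 ^ (k + 2) ∣ Fintype.card F - 1) :
    Nat.card {α : Fin (k + 1) → F // IsSqChain α} = 2 ^ (k + 1) := by
  induction k with
  | zero =>
    obtain ⟨c, hc⟩ := hdvd
    have hroots := FiniteField.card_pow_eq (F := F) (n := 2) (m := 2 * c) (x := -1)
      (by rw [hc]; ring) (by rw [pow_mul]; simp)
    refine Eq.trans ?_ hroots
    refine Nat.card_congr ((Equiv.funUnique (Fin 1) F).subtypeEquiv fun α => ?_)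
    simp [IsSqChain]
  | succ k ih =>
    obtain ⟨c, hc⟩ := hdvd
    simp only [isSqChain_succ_iff]
    rw [Fin.card_init_and_last (fun a : Fin (k + 1) → F => IsSqChain a)
      (fun a x => x ^ 2 * a (Fin.last k) = -1) 2, ih ⟨2 * c, by rw [hc]; ring⟩, ← pow_succ]
    intro a ha
    have hpow : a (Fin.last k) ^ 2 ^ (k + 2) = 1 := ha.pow_eq_one k (by omega)
    have hne : a (Fin.last k) ≠ 0 := by
      intro h0
      rw [h0, zero_pow (by positivity)] at hpow
      exact zero_ne_one hpow
    have heven : Even (2 ^ (k + 2)) := (Nat.even_pow.2 ⟨even_two, by omega⟩)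
    simp only [← eq_div_iff hne]
    refine FiniteField.card_pow_eq (m := 2 ^ (k + 2) * c) (by rw [hc]; ring) ?_
    rw [pow_mul, div_pow, hpow, heven.neg_one_pow, div_one, one_pow]

/-- `q` odd prime power, `t ≥ 2`, `q ≡ -1 (mod 2^t)`. The number of tuples
`(α₁, …, α_t)` in `𝔽_{q²}` with `α₁² = -1`, `α_i²·α_{i-1} = -1` for `2 ≤ i ≤ t-1`,
and `α_t^(q-1) = -α_{t-1}` is exactly `2^(t-1)·(q-1)`.  (Here `α (i-1)` encodes `α_i`.) -/
theorem stmt9 (q t : ℕ) (hq : IsPrimePow q) (hodd : Odd q) (ht : 2 ≤ t)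
    (hdvd : 2 ^ t ∣ q + 1)
    {F : Type*} [Field F] [Fintype F] (hF : Fintype.card F = q ^ 2) :
    Nat.card {α : Fin t → F //
      (α ⟨0, by omega⟩) ^ 2 = -1 ∧
      (∀ i : ℕ, ∀ _ : 2 ≤ i, ∀ _ : i ≤ t - 1,
        (α ⟨i - 1, by omega⟩) ^ 2 * α ⟨i - 2, by omega⟩ = -1) ∧
      (α ⟨t - 1, by omega⟩) ^ (q - 1) = -(α ⟨t - 2, by omega⟩)} =
    2 ^ (t - 1) * (q - 1) := by
  obtain ⟨k, rfl⟩ := Nat.exists_eq_add_of_le' ht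
  have hcard : Fintype.card F - 1 = (q - 1) * (q + 1) := by
    rw [hF, mul_comm, ← Nat.sq_sub_sq, one_pow]
  have hcount := Fin.card_init_and_last (fun a : Fin (k + 1) → F => IsSqChain a)
    (fun a x => x ^ (q - 1) = -a (Fin.last k)) (q - 1) fun a ha => by
      have hpow : a (Fin.last k) ^ 2 ^ (k + 2) = 1 := ha.pow_eq_one k (by omega)
      obtain ⟨c, hc⟩ := hdvd
      refine FiniteField.card_pow_eq hcard ?_
      rw [hodd.add_one.neg_pow, hc, pow_mul, hpow, one_pow]
  rw [card_isSqChain k (hcard ▸ hdvd.mul_left _)] at hcount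
  refine Eq.trans (Nat.card_congr (Equiv.subtypeEquivRight fun α => ?_)) hcount
  constructor
  · rintro ⟨h0, h, hl⟩
    exact ⟨⟨h0, fun i hi => h (i + 2) (by omega) (by omega)⟩, hl⟩
  · rintro ⟨⟨h0, h⟩, hl⟩
    refine ⟨h0, fun i hi hit => ?_, hl⟩
    obtain ⟨j, rfl⟩ := Nat.exists_eq_add_of_le' hi
    exact h j (by omega)
end

section
/- Let q be a prime power, let α ∈ 𝔽_{q²} with α^q ≠ α (i.e. α ∉ 𝔽_q), let K be a field extension of 𝔽_{q²}, and let β ∈ K satisfy β^{q-1} = 1 − (1+α)^{q-1}. Then β^{q²} = β if and only if (1+α)^{q-1} + (1+α)^{1-q} = 1. -/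
/-- `q = p^e`, `α ∈ 𝔽_{q²} \ 𝔽_q` inside `K ⊇ 𝔽_{q²}`, `β ∈ K` with
`β^(q-1) = 1 - (1+α)^(q-1)`.  Then `β ∈ 𝔽_{q²}` iff
`(1+α)^(q-1) + (1+α)^(1-q) = 1`. -/
theorem stmt10 (p e : ℕ) (hp : p.Prime) (he : 0 < e) {K : Type*} [Field K] [CharP K p]
    (α β : K) (hα2 : α ^ (p ^ e) ^ 2 = α) (hα : α ^ p ^ e ≠ α)
    (hβ : β ^ (p ^ e - 1) = 1 - (1 + α) ^ (p ^ e - 1)) :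
    β ^ (p ^ e) ^ 2 = β ↔
      (1 + α) ^ (p ^ e - 1) + ((1 + α) ^ (p ^ e - 1))⁻¹ = 1 := by
  have := Fact.mk hp
  have hq : p ^ e - 1 + 1 = p ^ e := Nat.sub_add_cancel (Nat.one_le_pow _ _ hp.pos)
  have hq1 : p ^ e - 1 ≠ 0 := by
    have := Nat.one_lt_pow he.ne' hp.one_lt
    omega
  have hγ : 1 + α ≠ 0 := by
    intro h
    have h' : (1 + α) ^ p ^ e = 1 + α := by
      rw [h, zero_pow (pow_ne_zero e hp.ne_zero)]
    rw [add_pow_char_pow, one_pow] at h'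
    exact hα (add_left_cancel h')
  have hγq : (1 + α) ^ p ^ e = (1 + α) ^ (p ^ e - 1) * (1 + α) := by
    rw [← pow_succ, hq]
  have hγ2 : (1 + α) ^ (p ^ e) ^ 2 = 1 + α := by
    rw [← pow_mul, add_pow_char_pow, one_pow, pow_mul, hα2]
  have hβq : β ^ p ^ e = (1 - (1 + α) ^ (p ^ e - 1)) * β := by
    rw [← hβ, ← pow_succ, hq]
  have hu0 : (1 + α) ^ (p ^ e - 1) ≠ 0 := pow_ne_zero _ hγ
  have hu1 : (1 + α) ^ (p ^ e - 1) ≠ 1 := by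
    intro h
    rw [h, one_mul, add_pow_char_pow, one_pow] at hγq
    exact hα (add_left_cancel hγq)
  generalize (1 + α) ^ (p ^ e - 1) = u at *
  have huq : u ^ p ^ e = u⁻¹ := by
    rw [sq, pow_mul, hγq, mul_pow, hγq, ← mul_assoc] at hγ2
    exact eq_inv_of_mul_eq_one_left (mul_right_cancel₀ hγ (hγ2.trans (one_mul _).symm))
  have hβ0 : β ≠ 0 := by
    rintro rfl
    rw [zero_pow hq1] at hβ
    exact hu1 (sub_eq_zero.mp hβ.symm).symm
  have hβ2 : β ^ (p ^ e) ^ 2 = (2 - (u + u⁻¹)) * β := by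
    rw [sq, pow_mul, hβq, mul_pow, hβq, sub_pow_char_pow, one_pow, huq]
    field_simp
    ring
  rw [hβ2, mul_eq_right₀ hβ0]
  constructor <;> intro h <;> linear_combination -h
end

section
/- Let q be a prime power and let α, α₁ ∈ 𝔽_{q²} with α₁ ≠ 0, α₁^q ≠ α₁ (i.e. α₁ ∉ 𝔽_q), and α₁^{q-1} = 1 − (1+α)^{q-1}. Set u = (1+α)^{q-1} and v = (1+α₁)^{q-1}, and suppose u² − u + 1 = 0 and v² − v + 1 = 0. Then u = v. -/
/-- The Claim: with `α, α₁ ∈ 𝔽_{q²}`, `α₁ ≠ 0`, `α₁ ∉ 𝔽_q`,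
`α₁^(q-1) = 1 - (1+α)^(q-1)`, if `u = (1+α)^(q-1)` and `v = (1+α₁)^(q-1)` are both
roots of `X² - X + 1`, then `u = v`. -/
theorem stmt11 (p e : ℕ) (hp : p.Prime) (he : 0 < e) {F : Type*} [Field F] [Fintype F]
    [CharP F p] (hF : Fintype.card F = (p ^ e) ^ 2)
    (α α₁ : F) (h0 : α₁ ≠ 0) (h1 : α₁ ^ p ^ e ≠ α₁)
    (hrec : α₁ ^ (p ^ e - 1) = 1 - (1 + α) ^ (p ^ e - 1))
    (hu : ((1 + α) ^ (p ^ e - 1)) ^ 2 - (1 + α) ^ (p ^ e - 1) + 1 = 0)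
    (hv : ((1 + α₁) ^ (p ^ e - 1)) ^ 2 - (1 + α₁) ^ (p ^ e - 1) + 1 = 0) :
    (1 + α) ^ (p ^ e - 1) = (1 + α₁) ^ (p ^ e - 1) := by
  have : Fact p.Prime := ⟨hp⟩
  have hq : p ^ e ≠ 0 := pow_ne_zero e hp.ne_zero
  have hfrob : (1 + α₁) ^ p ^ e = 1 + α₁ ^ p ^ e := by
    rw [add_pow_char_pow, one_pow]
  rw [← pow_sub_one_mul hq (1 + α₁), ← pow_sub_one_mul hq α₁, hrec] at hfrob
  generalize (1 + α) ^ (p ^ e - 1) = u at *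
  generalize (1 + α₁) ^ (p ^ e - 1) = v at *
  have hprod : (u - v) * (u + v - 1) = 0 := by linear_combination hu - hv
  rcases mul_eq_zero.mp hprod with h | h
  · exact sub_eq_zero.mp h
  · have hzero : u = 0 := by linear_combination (1 + α₁) * h - hfrob
    simp [hzero] at hu
end

section
/- Let q = 3^e be a power of 3 and let K be a field extension of 𝔽_q. There is no element x ∈ K satisfying both x^{q-1} = −1 and (1+x)^{q-1} = −1. -/
/-- `q = 3^e`, `K ⊇ 𝔽_q` (so `char K = 3`): there is no `x ∈ K` with
`x^(q-1) = -1` and `(1+x)^(q-1) = -1`. -/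
theorem stmt12 (e : ℕ) (he : 0 < e) {K : Type*} [Field K] [CharP K 3] :
    ¬ ∃ x : K, x ^ (3 ^ e - 1) = -1 ∧ (1 + x) ^ (3 ^ e - 1) = -1 := by
  rintro ⟨x, hx, hy⟩
  have : Fact (Nat.Prime 3) := ⟨Nat.prime_three⟩
  have pow_eq_neg (y : K) (h : y ^ (3 ^ e - 1) = -1) : y ^ 3 ^ e = -y := by
    rw [← pow_sub_one_mul (pow_ne_zero e three_ne_zero) y, h, neg_one_mul]
  have hadd : (1 + x) ^ 3 ^ e = 1 + x ^ 3 ^ e := by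
    rw [add_pow_char_pow, one_pow]
  rw [pow_eq_neg _ hy, pow_eq_neg _ hx] at hadd
  have h3 : (3 : K) = 0 := by exact_mod_cast CharP.cast_eq_zero K 3
  exact one_ne_zero (α := K) (by linear_combination h3 + hadd)
end

section
/- Let q = p^e be a prime power with p ≠ 3, and let α ∈ 𝔽_{q²} with α^q ≠ α (i.e. α ∉ 𝔽_q). Set u = (1+α)^{q-1} and suppose u² − u + 1 = 0. Then: (i) 1 − (1+α)^{2q-2} ≠ 0; (ii) the element c := ((1+α)^{2q-1} − (1+α)^q)/(1 − (1+α)^{2q-2}) satisfies c^q = c and c ≠ 0 (i.e. c ∈ 𝔽_q^*); and (iii) the element α₁ := c/(1+α) satisfies α₁^{q-1} = 1 − (1+α)^{q-1} and (1+α₁)^{q-1} = (1+α)^{q-1}. -/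
/-- If `y ≠ 0` and `y ^ q = a * y` then `y ^ (q - 1) = a`. -/
theorem pow_sub_one_eq_of_pow_eq_mul {F : Type*} [Field F] {q : ℕ} (hq : 0 < q) {y a : F}
    (hy : y ≠ 0) (h : y ^ q = a * y) : y ^ (q - 1) = a := by
  apply mul_right_cancel₀ hy
  rw [pow_sub_one_mul hq.ne', h]

/-- `q = p^e`, `p ≠ 3`, `α ∈ 𝔽_{q²} \ 𝔽_q`, `u = (1+α)^(q-1)` with `u² - u + 1 = 0`.
Then (i) `1 - (1+α)^(2q-2) ≠ 0`; (ii) `c = ((1+α)^(2q-1) - (1+α)^q)/(1 - (1+α)^(2q-2))`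
lies in `𝔽_q^*`; (iii) `α₁ = c/(1+α)` satisfies `α₁^(q-1) = 1 - (1+α)^(q-1)` and
`(1+α₁)^(q-1) = (1+α)^(q-1)`. -/
theorem stmt13 (p e : ℕ) (hp : p.Prime) (hp3 : p ≠ 3) (he : 0 < e)
    {F : Type*} [Field F] [Fintype F] [CharP F p] (hF : Fintype.card F = (p ^ e) ^ 2)
    (α : F) (hα : α ^ p ^ e ≠ α)
    (hu : ((1 + α) ^ (p ^ e - 1)) ^ 2 - (1 + α) ^ (p ^ e - 1) + 1 = 0) :
    1 - (1 + α) ^ (2 * p ^ e - 2) ≠ 0 ∧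
    ∀ c : F, c = ((1 + α) ^ (2 * p ^ e - 1) - (1 + α) ^ p ^ e) /
        (1 - (1 + α) ^ (2 * p ^ e - 2)) →
    ∀ α₁ : F, α₁ = c / (1 + α) →
      (c ^ p ^ e = c ∧ c ≠ 0) ∧
      α₁ ^ (p ^ e - 1) = 1 - (1 + α) ^ (p ^ e - 1) ∧
      (1 + α₁) ^ (p ^ e - 1) = (1 + α) ^ (p ^ e - 1) := by
  have := Fact.mk hp
  have hq : 0 < p ^ e := pow_pos hp.pos e
  have hx : 1 + α ≠ 0 := by
    intro h
    apply hα
    have hneg : α ^ p ^ e + 1 = 0 := by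
      rw [← one_pow (p ^ e), ← add_pow_char_pow, add_comm, h, zero_pow hq.ne']
    linear_combination hneg - h
  have h3 : (3 : F) ≠ 0 := by
    intro h
    have h' : ((3 : ℕ) : F) = 0 := by exact_mod_cast h
    rw [CharP.cast_eq_zero_iff F p, Nat.prime_dvd_prime_iff_eq hp Nat.prime_three] at h'
    exact hp3 h'
  have hxq : (1 + α) ^ p ^ e = (1 + α) ^ (p ^ e - 1) * (1 + α) := (pow_sub_one_mul hq.ne' _).symm
  have hx2 : (1 + α) ^ (2 * p ^ e - 2) = ((1 + α) ^ (p ^ e - 1)) ^ 2 := by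
    rw [← pow_mul]; congr 1; lia
  have hx21 : (1 + α) ^ (2 * p ^ e - 1) = ((1 + α) ^ (p ^ e - 1)) ^ 2 * (1 + α) := by
    rw [← pow_mul, ← pow_succ]; congr 1; lia
  have hxqq : ((1 + α) ^ p ^ e) ^ p ^ e = 1 + α := by
    rw [← pow_mul, ← sq, ← hF, FiniteField.pow_card]
  rw [hx2, hx21, hxq]
  have huq : ((1 + α) ^ (p ^ e - 1)) ^ p ^ e * (1 + α) ^ (p ^ e - 1) = 1 := by
    apply mul_right_cancel₀ hx
    rw [mul_assoc, ← hxq, ← mul_pow, ← hxq, hxqq, one_mul]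
  generalize (1 + α) ^ (p ^ e - 1) = u at *
  generalize 1 + α = x at *
  have hu0 : u ≠ 0 := right_ne_zero_of_mul_eq_one huq
  have huq' : u ^ p ^ e = 1 - u := by
    apply mul_right_cancel₀ hu0
    linear_combination huq + hu
  have hd : u - 2 ≠ 0 := by
    intro h
    apply h3
    linear_combination hu - (u + 1) * h
  have hdu : 1 - u ^ 2 = -(u - 2) := by linear_combination -hu
  have hu1 : u - 1 ≠ 0 := by
    intro h
    apply one_ne_zero (α := F)
    linear_combination hu - u * h
  have hdq : (u - 2) ^ p ^ e = -(1 + u) := by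
    rw [show u - 2 = u - 1 - 1 by ring, sub_pow_char_pow, sub_pow_char_pow, huq', one_pow]
    ring
  have hs : 1 + u ≠ 0 := by
    rw [← neg_ne_zero, ← hdq]
    exact pow_ne_zero _ hd
  have hc : (u ^ 2 * x - u * x) / (1 - u ^ 2) = x / (u - 2) := by
    rw [hdu]
    field_simp
    linear_combination -hu
  refine ⟨by rw [hdu]; exact neg_ne_zero.mpr hd, ?_⟩
  rintro c rfl α₁ rfl
  have hα₁ : x / (u - 2) / x = 1 / (u - 2) := by field_simp
  have hα₁' : 1 + 1 / (u - 2) = (u - 1) / (u - 2) := by field_simp; ring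
  rw [hc, hα₁, hα₁']
  refine ⟨⟨?_, div_ne_zero hx hd⟩,
    pow_sub_one_eq_of_pow_eq_mul hq (one_div_ne_zero hd) ?_,
    pow_sub_one_eq_of_pow_eq_mul hq (div_ne_zero hu1 hd) ?_⟩
  · rw [div_pow, hdq, hxq, div_eq_div_iff (neg_ne_zero.mpr hs) hd]
    linear_combination x * hu
  · rw [div_pow, hdq, one_pow, mul_one_div, div_eq_div_iff (neg_ne_zero.mpr hs) hd]
    linear_combination -hu
  · rw [div_pow, hdq, sub_pow_char_pow, huq', one_pow, ← mul_div_assoc,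
      div_eq_div_iff (neg_ne_zero.mpr hs) hd]
    linear_combination u * hu
end
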